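/- Let X be a set of 11 distinct points of the projective plane P^2 over k with generic Hilbert function. Then for every integer t ≥ 0 one has H_{2X}(t) ≥ m(t), where m(t) = binom(t+2,2) for 0 ≤ t ≤ 5, m(6) = 26, m(7) = 31, m(8) = 32, and m(t) = 33 for all t ≥ 9. (That is, the Hilbert function of any double point scheme supported on 11 points with generic Hilbert function is bounded below pointwise by the Hilbert function of the double point scheme on the configuration C_{5,1}.) -/

import Mathlib

open MvPolynomial

/-- The vanishing (prime) ideal of a point of ℙ²: the ideal generated by the
linear forms vanishing at the point. -/
noncomputable def pointIdeal (k : Type) [Field k] (P : Projectivization k (Fin 3 → k)) :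
    Ideal (MvPolynomial (Fin 3) k) :=
  Ideal.span {f : MvPolynomial (Fin 3) k | f.IsHomogeneous 1 ∧ eval P.rep f = 0}

/-- The Hilbert function of R/I: H(t) = dim_k R_t − dim_k I_t. -/
noncomputable def hilbertFunction (k : Type) [Field k]
    (I : Ideal (MvPolynomial (Fin 3) k)) (t : ℕ) : ℕ :=
  Module.finrank k ↥(homogeneousSubmodule (Fin 3) k t) -
    Module.finrank k ↥(Submodule.restrictScalars k I ⊓ homogeneousSubmodule (Fin 3) k t)

/-- The defining ideal `I_X` of a finite set of points. -/
noncomputable def idealOfPoints (k : Type) [Field k] {s : ℕ}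
    (P : Fin s → Projectivization k (Fin 3 → k)) : Ideal (MvPolynomial (Fin 3) k) :=
  ⨅ i, pointIdeal k (P i)

/-- The defining ideal `I_{2X}` of the double point scheme supported on a finite set of points. -/
noncomputable def doubleIdealOfPoints (k : Type) [Field k] {s : ℕ}
    (P : Fin s → Projectivization k (Fin 3 → k)) : Ideal (MvPolynomial (Fin 3) k) :=
  ⨅ i, (pointIdeal k (P i)) ^ 2

/-- `X` has generic Hilbert function: `H_X(t) = min {s, binom(t+2,2)}` for all `t`. -/
def HasGenericHilbertFunction (k : Type) [Field k] {s : ℕ}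
    (P : Fin s → Projectivization k (Fin 3 → k)) : Prop :=
  ∀ t : ℕ, hilbertFunction k (idealOfPoints k P) t = min s (Nat.choose (t + 2) 2)

section DoublePoints

variable {k : Type} [Field k]

open Matrix

theorem finrank_homogeneousSubmodule_fin_three (t : ℕ) :
    Module.finrank k (homogeneousSubmodule (Fin 3) k t) = (t + 2).choose 2 := by
  have hset : {d : Fin 3 →₀ ℕ | d.degree = t} =
      ((Finset.univ : Finset (Fin 3)).finsuppAntidiag t : Set (Fin 3 →₀ ℕ)) := by
    ext d
    simp [Finset.mem_finsuppAntidiag, Finsupp.degree_eq_sum]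
  rw [homogeneousSubmodule_eq_finsupp_supported,
    (AddMonoidAlgebra.supportedEquivFinsupp (R := k) (S := k)
      {d : Fin 3 →₀ ℕ | d.degree = t}).finrank_eq,
    hset, Module.finrank_finsupp_self]
  simp only [Finset.coe_sort_coe, Fintype.card_coe]
  rw [Finset.card_finsuppAntidiag_nat_eq_choose, Finset.card_univ, Fintype.card_fin,
    Nat.add_comm 3, show t + 3 - 1 = t + 2 by omega,
    ← Nat.choose_symm_of_eq_add (by omega : t + 2 = 2 + t)]

instance homogeneousSubmodule_finite (t : ℕ) :
    Module.Finite k (homogeneousSubmodule (Fin 3) k t) :=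
  Module.Finite.iff_fg.mpr (homogeneousSubmodule_fg _ _ t)

/-- The derivative at the point `p` in the direction `u`. -/
noncomputable def dirDeriv (u p : Fin 3 → k) : MvPolynomial (Fin 3) k →ₗ[k] k :=
  ∑ j, u j • (aeval p).toLinearMap ∘ₗ (pderiv j).toLinearMap

theorem dirDeriv_apply (u p : Fin 3 → k) (F : MvPolynomial (Fin 3) k) :
    dirDeriv u p F = ∑ j, u j * eval p (pderiv j F) := by
  simp [dirDeriv, LinearMap.sum_apply, aeval_eq_eval]

theorem dirDeriv_mul (u p : Fin 3 → k) (F G : MvPolynomial (Fin 3) k) :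
    dirDeriv u p (F * G) = dirDeriv u p F * eval p G + eval p F * dirDeriv u p G := by
  simp only [dirDeriv_apply, Fin.sum_univ_three, Derivation.leibniz, smul_eq_mul, map_add, map_mul]
  ring

theorem dirDeriv_add_dir (u v p : Fin 3 → k) (F : MvPolynomial (Fin 3) k) :
    dirDeriv (u + v) p F = dirDeriv u p F + dirDeriv v p F := by
  simp only [dirDeriv_apply, Fin.sum_univ_three, Pi.add_apply]
  ring

theorem dirDeriv_smul_dir (r : k) (u p : Fin 3 → k) (F : MvPolynomial (Fin 3) k) :
    dirDeriv (r • u) p F = r * dirDeriv u p F := by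
  simp only [dirDeriv_apply, Fin.sum_univ_three, Pi.smul_apply, smul_eq_mul]
  ring

theorem dirDeriv_self (p : Fin 3 → k) {F : MvPolynomial (Fin 3) k} {t : ℕ}
    (hF : F.IsHomogeneous t) : dirDeriv p p F = t * eval p F := by
  have h := congrArg (eval p) hF.sum_X_mul_pderiv
  simpa [dirDeriv_apply] using h

/-- The linear form with coefficient vector `a`. -/
noncomputable def linForm (a : Fin 3 → k) : MvPolynomial (Fin 3) k := ∑ j, C (a j) * X j

theorem linForm_isHomogeneous (a : Fin 3 → k) : (linForm a).IsHomogeneous 1 :=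
  IsHomogeneous.sum _ _ _ fun _ _ => isHomogeneous_C_mul_X _ _

theorem eval_linForm (a p : Fin 3 → k) : eval p (linForm a) = a ⬝ᵥ p := by
  simp [linForm, dotProduct]

theorem dirDeriv_linForm (a u p : Fin 3 → k) : dirDeriv u p (linForm a) = a ⬝ᵥ u := by
  simp only [dirDeriv_apply, linForm, Fin.sum_univ_three, dotProduct, map_add, Derivation.leibniz,
    pderiv_C, pderiv_X, smul_eq_mul, mul_zero, map_mul, eval_C]
  simp
  ring

theorem dirDeriv_pow_two {p : Fin 3 → k} (u : Fin 3 → k) {F : MvPolynomial (Fin 3) k}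
    (hF : eval p F = 0) : dirDeriv u p (F ^ 2) = 0 := by
  rw [pow_two, dirDeriv_mul, hF]
  ring

theorem exists_eq_smul_of_cross_eq_zero {u p : Fin 3 → k} (hp : p ≠ 0) (h : u ⨯₃ p = 0) :
    ∃ μ : k, u = μ • p := by
  by_contra! hne
  have hli : LinearIndependent k ![p, u] :=
    (LinearIndependent.pair_iff' hp).mpr fun μ => (hne μ).symm
  refine crossProduct_ne_zero_iff_linearIndependent.mpr hli ?_
  rw [← cross_anticomm, h, neg_zero]

theorem exists_dotProduct_ne_zero [Infinite k] {ι : Type} [Finite ι] (p : ι → Fin 3 → k)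
    (hp : ∀ i, p i ≠ 0) : ∃ m : Fin 3 → k, ∀ i, m ⬝ᵥ p i ≠ 0 := by
  obtain ⟨f, hf⟩ := Module.exists_dual_forall_apply_ne_zero (K := k) p hp
  refine ⟨(dotProductEquiv k (Fin 3)).symm f, fun i => ?_⟩
  rw [← dotProductEquiv_apply_apply, LinearEquiv.apply_symm_apply]
  exact hf i
theorem finrank_le_of_injOn {ι : Type} [Finite ι]
    {N : Submodule k (ι → Fin 3 → k)} {W : Submodule k (Fin 3 → k)}
    (φ : (ι → Fin 3 → k) →ₗ[k] (Fin 3 → k)) (h1 : ∀ v ∈ N, φ v ∈ W)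
    (h2 : ∀ v ∈ N, φ v = 0 → v = 0) : Module.finrank k N ≤ Module.finrank k W := by
  refine LinearMap.finrank_le_finrank_of_injective (f := φ.restrict h1) ?_
  rw [← LinearMap.ker_eq_bot, LinearMap.ker_eq_bot']
  rintro ⟨v, hv⟩ h
  exact Subtype.ext (h2 v hv (congrArg Subtype.val h))

theorem finrank_orthogonal_singleton {a : Fin 3 → k} (ha : a ≠ 0) :
    Module.finrank k (LinearMap.ker (dotProductEquiv k (Fin 3) a)) = 2 := by
  have h := Module.Dual.finrank_ker_add_one_of_ne_zero (f := dotProductEquiv k (Fin 3) a)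
    (by simpa using ha)
  rw [Module.finrank_fin_fun] at h
  omega

section Relations

variable {ι : Type} {p : ι → Fin 3 → k} {v : ι → Fin 3 → k}

/-- The forms of degree `t` singular at all the points `p i`. -/
def singularForms (p : ι → Fin 3 → k) (t : ℕ) : Submodule k (MvPolynomial (Fin 3) k) where
  carrier := {F | F.IsHomogeneous t ∧ ∀ i u, dirDeriv u (p i) F = 0}
  add_mem' {F G} hF hG := ⟨hF.1.add hG.1, fun i u => by simp [hF.2, hG.2]⟩
  zero_mem' := ⟨isHomogeneous_zero _ _ _, by simp⟩
  smul_mem' r F hF := ⟨(homogeneousSubmodule (Fin 3) k t).smul_mem r hF.1,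
    fun i u => by simp [hF.2]⟩

theorem singularForms_le (p : ι → Fin 3 → k) (t : ℕ) :
    singularForms p t ≤ homogeneousSubmodule (Fin 3) k t := fun _ hF => hF.1

instance singularForms_finite (p : ι → Fin 3 → k) (t : ℕ) :
    Module.Finite k (singularForms p t) :=
  Submodule.finiteDimensional_of_le (singularForms_le p t)

theorem exists_sextic_singular [DecidableEq ι] {m : Fin 3 → k} (hm : ∀ i, m ⬝ᵥ p i ≠ 0)
    (hsep : ∀ i j, i ≠ j → ∃ b : Fin 3 → k, b ⬝ᵥ p i = 0 ∧ b ⬝ᵥ p j ≠ 0)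
    {T : Finset ι} (hT : T.card ≤ 3) {j : ι} (hj : j ∉ T) :
    ∃ G : MvPolynomial (Fin 3) k, G.IsHomogeneous 6 ∧ eval (p j) G ≠ 0 ∧
      ∀ l ∈ T, eval (p l) G = 0 ∧ ∀ u, dirDeriv u (p l) G = 0 := by
  have hb : ∀ l, ∃ b : Fin 3 → k, l ∈ T → b ⬝ᵥ p l = 0 ∧ b ⬝ᵥ p j ≠ 0 := fun l => by
    by_cases hl : l ∈ T
    · obtain ⟨b, hb⟩ := hsep l j (fun h => hj (h ▸ hl))
      exact ⟨b, fun _ => hb⟩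
    · exact ⟨0, fun h => absurd h hl⟩
  choose b hb using hb
  refine ⟨(∏ l ∈ T, linForm (b l) ^ 2) * linForm m ^ (6 - 2 * T.card), ?_, ?_, fun l hl => ?_⟩
  · have h1 : (∏ l ∈ T, linForm (b l) ^ 2).IsHomogeneous (∑ _l ∈ T, 2) :=
      IsHomogeneous.prod _ _ _ fun l _ => by simpa using (linForm_isHomogeneous (b l)).pow 2
    have h2 := h1.mul ((linForm_isHomogeneous m).pow (6 - 2 * T.card))
    rw [Finset.sum_const, smul_eq_mul] at h2
    convert h2 using 1
    omega
  · rw [map_mul, map_prod]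
    refine mul_ne_zero (Finset.prod_ne_zero_iff.mpr fun l hl => ?_) ?_
    · rw [map_pow, eval_linForm]
      exact pow_ne_zero _ (hb l hl).2
    · rw [map_pow, eval_linForm]
      exact pow_ne_zero _ (hm j)
  · have h0 : eval (p l) (linForm (b l)) = 0 := by rw [eval_linForm, (hb l hl).1]
    rw [← Finset.mul_prod_erase T _ hl, mul_assoc]
    refine ⟨by rw [map_mul, map_pow, h0]; ring, fun u => ?_⟩
    rw [dirDeriv_mul, dirDeriv_pow_two u h0, map_pow, h0]
    ring

variable [Fintype ι]

/-- The linear relations in degree `t` between the first-order data at the points `p i`. -/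
def jetRelations (p : ι → Fin 3 → k) (t : ℕ) : Submodule k (ι → Fin 3 → k) where
  carrier := {v | ∀ F : MvPolynomial (Fin 3) k, F.IsHomogeneous t →
    ∑ i, dirDeriv (v i) (p i) F = 0}
  add_mem' {v w} hv hw F hF := by
    simp [dirDeriv_add_dir, Finset.sum_add_distrib, hv F hF, hw F hF]
  zero_mem' F _ := by simp [dirDeriv_apply]
  smul_mem' r v hv F hF := by
    simp [dirDeriv_smul_dir, ← Finset.mul_sum, hv F hF]

theorem finrank_singularForms_add_le (p : ι → Fin 3 → k) (t : ℕ) :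
    Module.finrank k (singularForms p t) + 3 * Fintype.card ι ≤
      (t + 2).choose 2 + Module.finrank k (jetRelations p t) := by
  classical
  let J : MvPolynomial (Fin 3) k →ₗ[k] (ι × Fin 3 → k) :=
    LinearMap.pi fun x => dirDeriv (Pi.single x.2 1) (p x.1)
  let Jt := J.domRestrict (homogeneousSubmodule (Fin 3) k t)
  have hker : singularForms p t = (LinearMap.ker Jt).map (Submodule.subtype _) := by
    ext F
    simp only [Submodule.mem_map, LinearMap.mem_ker, Submodule.subtype_apply, Subtype.exists,
      exists_and_right, exists_eq_right]
    refine ⟨fun hF => ⟨hF.1, ?_⟩, fun ⟨h, hF⟩ => ⟨h, fun i u => ?_⟩⟩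
    · ext x
      exact hF.2 _ _
    · have h0 : ∀ j, eval (p i) (pderiv j F) = 0 := fun j => by
        have := congrFun hF (i, j)
        simpa [Jt, J, dirDeriv_apply, Pi.single_apply] using this
      simp [dirDeriv_apply, h0]
  have h1 := LinearMap.finrank_range_add_finrank_ker Jt
  have h2 := Subspace.finrank_add_finrank_dualAnnihilator_eq (LinearMap.range Jt)
  rw [finrank_homogeneousSubmodule_fin_three] at h1
  rw [Module.finrank_fintype_fun_eq_card, Fintype.card_prod, Fintype.card_fin] at h2
  rw [hker, Submodule.finrank_map_subtype_eq]
  let T : Module.Dual k (ι × Fin 3 → k) →ₗ[k] (ι → Fin 3 → k) :=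
    LinearMap.pi fun i => LinearMap.pi fun j => LinearMap.applyₗ (Pi.single (i, j) 1)
  have hT : Function.Injective T := fun φ ψ h => LinearMap.pi_ext' fun x => by
    ext
    exact congrFun (congrFun h x.1) x.2
  have h3 : (LinearMap.range Jt).dualAnnihilator.map T ≤ jetRelations p t := by
    rintro _ ⟨φ, hφ, rfl⟩ F hF
    have := (Submodule.mem_dualAnnihilator φ).mp hφ (J F) ⟨⟨F, hF⟩, rfl⟩
    rw [← this, pi_eq_sum_univ' (J F), map_sum, Fintype.sum_prod_type]
    refine Finset.sum_congr rfl fun i _ => ?_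
    rw [dirDeriv_apply]
    refine Finset.sum_congr rfl fun j _ => ?_
    have h1 : J F (i, j) = eval (p i) (pderiv j F) := by
      simp [J, dirDeriv_apply, Pi.single_apply]
    rw [map_smul, smul_eq_mul, h1, mul_comm]
    rfl
  have h4 := Submodule.finrank_mono h3
  rw [LinearEquiv.finrank_eq (Submodule.equivMapOfInjective T hT _).symm] at h4
  omega

theorem jetRelations_apply_eq_zero [CharZero k] {t : ℕ} (hv : v ∈ jetRelations p (t + 1)) {i : ι}
    (hi : p i ≠ 0) {G : MvPolynomial (Fin 3) k} (hG : G.IsHomogeneous t)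
    (hGi : eval (p i) G ≠ 0)
    (hGj : ∀ j, j ≠ i → v j = 0 ∨ eval (p j) G = 0 ∧ dirDeriv (v j) (p j) G = 0) : v i = 0 := by
  have key : ∀ a : Fin 3 → k,
      dirDeriv (v i) (p i) G * (a ⬝ᵥ p i) + eval (p i) G * (a ⬝ᵥ v i) = 0 := by
    intro a
    have h := hv (G * linForm a) (hG.mul (linForm_isHomogeneous a))
    rwa [Fintype.sum_eq_single i fun j hj => ?_, dirDeriv_mul, eval_linForm, dirDeriv_linForm] at h
    rcases hGj j hj with h | ⟨h, h'⟩
    · simp [h, dirDeriv_apply]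
    · simp [dirDeriv_mul, h, h']
  have hvec : dirDeriv (v i) (p i) G • p i + eval (p i) G • v i = 0 := by
    ext j
    simpa using key (Pi.single j 1)
  obtain ⟨μ, hμ⟩ : ∃ μ : k, v i = μ • p i := by
    refine ⟨-((eval (p i) G)⁻¹ * dirDeriv (v i) (p i) G), ?_⟩
    rw [eq_comm, neg_smul, mul_smul, neg_eq_iff_add_eq_zero, ← smul_right_injective _ hGi |>.eq_iff]
    simpa [smul_smul, hGi] using hvec
  rw [hμ, dirDeriv_smul_dir, dirDeriv_self _ hG, smul_smul, ← add_smul, smul_eq_zero,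
    or_iff_left hi] at hvec
  have h0 : μ * (eval (p i) G * (t + 1)) = 0 := by linear_combination hvec
  have ht : (t + 1 : k) ≠ 0 := by exact_mod_cast t.succ_ne_zero
  rw [mul_eq_zero, or_iff_left (mul_ne_zero hGi ht)] at h0
  rw [hμ, h0, zero_smul]

theorem eq_zero_of_mem_jetRelations_of_eq_smul [CharZero k] [DecidableEq ι]
    {m : Fin 3 → k} (hm : ∀ i, m ⬝ᵥ p i ≠ 0)
    (hQ : ∀ w : ι → k, ∃ Q : MvPolynomial (Fin 3) k, Q.IsHomogeneous 4 ∧ ∀ i, eval (p i) Q = w i)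
    (n : ℕ) (hv : v ∈ jetRelations p (4 + n)) (h : ∀ i, ∃ μ : k, v i = μ • p i) : v = 0 := by
  choose μ hμ using h
  funext i
  obtain ⟨Q, hQ4, hQw⟩ := hQ (Pi.single i 1)
  have hF : (Q * linForm m ^ n).IsHomogeneous (4 + n) := by
    simpa using hQ4.mul ((linForm_isHomogeneous m).pow n)
  have hs := hv _ hF
  simp only [hμ, dirDeriv_smul_dir, dirDeriv_self _ hF, map_mul, hQw, map_pow, eval_linForm] at hs
  rw [Fintype.sum_eq_single i fun j hj => by simp [hj]] at hs
  have h4 : ((4 + n : ℕ) : k) ≠ 0 := by exact_mod_cast (by omega)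
  have h0 : μ i = 0 := by
    simpa [-Nat.cast_add, h4, hm i] using hs
  rw [hμ, h0, zero_smul, Pi.zero_apply]

theorem exists_eq_smul_of_dirDeriv_quartic_eq_zero [DecidableEq ι] {c : ι → k}
    (hC : ∀ w : ι → k, c ⬝ᵥ w = 0 →
      ∃ Q : MvPolynomial (Fin 3) k, Q.IsHomogeneous 3 ∧ ∀ i, eval (p i) Q = w i)
    (hS : ∀ a : Fin 3 → k, (∀ j, c j ≠ 0 → a ⬝ᵥ p j = 0) → a = 0)
    {i : ι} (hi : p i ≠ 0) {u : Fin 3 → k}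
    (hu : ∀ G : MvPolynomial (Fin 3) k, G.IsHomogeneous 4 → (∀ j, eval (p j) G = 0) →
      dirDeriv u (p i) G = 0) : ∃ μ : k, u = μ • p i := by
  have key : ∀ (e : Fin 3 → k) (w : ι → k), c ⬝ᵥ w = 0 →
      (∀ j, j ≠ i → w j = 0 ∨ p j = e) → w i * (u ⨯₃ p i ⬝ᵥ e) = 0 := by
    intro e w hw hj
    obtain ⟨Q, hQ3, hQw⟩ := hC w hw
    have hG := hu (Q * linForm (p i ⨯₃ e)) (hQ3.mul (linForm_isHomogeneous _)) fun j => by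
      rw [map_mul, hQw, eval_linForm]
      by_cases hji : j = i
      · rw [hji, dotProduct_comm (p i ⨯₃ e), dot_self_cross, mul_zero]
      · rcases hj j hji with h | h
        · rw [h, zero_mul]
        · rw [h, dotProduct_comm, dot_cross_self, mul_zero]
    rw [dirDeriv_mul, eval_linForm, dirDeriv_linForm, hQw, dotProduct_comm (p i ⨯₃ e),
      dot_self_cross, mul_zero, zero_add] at hG
    rwa [dotProduct_comm (u ⨯₃ p i), ← triple_product_permutation (p i),
      ← triple_product_permutation u, dotProduct_comm u]
  refine exists_eq_smul_of_cross_eq_zero hi ?_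
  by_cases hci : c i = 0
  · refine dotProduct_eq_zero _ fun e => ?_
    simpa using key e (Pi.single i 1) (by simp [hci]) fun j hj => Or.inl (by simp [hj])
  · refine hS _ fun j hj => ?_
    by_cases hji : j = i
    · rw [hji, dotProduct_comm, dot_cross_self]
    · have := key (p j) (Pi.single i (c j) - Pi.single j (c i))
        (by simp [dotProduct_sub, mul_comm]) fun l hl => by
          by_cases hlj : l = j
          · exact Or.inr (by rw [hlj])
          · exact Or.inl (by simp [hl, hlj])
      simpa [Ne.symm hji, hj] using this

theorem dirDeriv_quartic_eq_zero_of_mem_jetRelations [DecidableEq ι]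
    (hQ : ∀ w : ι → k, ∃ Q : MvPolynomial (Fin 3) k, Q.IsHomogeneous 4 ∧ ∀ i, eval (p i) Q = w i)
    (hv : v ∈ jetRelations p 8) {G : MvPolynomial (Fin 3) k} (hG : G.IsHomogeneous 4)
    (hGp : ∀ j, eval (p j) G = 0) (i : ι) : dirDeriv (v i) (p i) G = 0 := by
  obtain ⟨Q, hQ4, hQw⟩ := hQ (Pi.single i 1)
  have h := hv _ (hG.mul hQ4)
  simpa [dirDeriv_mul, hGp, hQw, Pi.single_apply] using h

theorem dirDeriv_quartic_proportional_of_mem_jetRelations [DecidableEq ι] {c : ι → k}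
    (hC : ∀ w : ι → k, c ⬝ᵥ w = 0 →
      ∃ Q : MvPolynomial (Fin 3) k, Q.IsHomogeneous 3 ∧ ∀ i, eval (p i) Q = w i)
    (hv : v ∈ jetRelations p 7) {G : MvPolynomial (Fin 3) k} (hG : G.IsHomogeneous 4)
    (hGp : ∀ j, eval (p j) G = 0) (i j : ι) :
    c i * dirDeriv (v j) (p j) G = c j * dirDeriv (v i) (p i) G := by
  obtain ⟨Q, hQ3, hQw⟩ := hC (Pi.single i (c j) - Pi.single j (c i))
    (by simp [dotProduct_sub, mul_comm])
  have h := hv _ (hG.mul hQ3)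
  simp [dirDeriv_mul, hGp, hQw, Pi.single_apply, mul_sub] at h
  linear_combination -h

theorem jetRelations_eight_eq_bot_of_not_collinear [CharZero k] [DecidableEq ι]
    {m : Fin 3 → k} (hm : ∀ i, m ⬝ᵥ p i ≠ 0) {c : ι → k}
    (hQ : ∀ w : ι → k, ∃ Q : MvPolynomial (Fin 3) k, Q.IsHomogeneous 4 ∧ ∀ i, eval (p i) Q = w i)
    (hC : ∀ w : ι → k, c ⬝ᵥ w = 0 →
      ∃ Q : MvPolynomial (Fin 3) k, Q.IsHomogeneous 3 ∧ ∀ i, eval (p i) Q = w i)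
    (hS : ∀ a : Fin 3 → k, (∀ j, c j ≠ 0 → a ⬝ᵥ p j = 0) → a = 0) :
    jetRelations p 8 = ⊥ := by
  refine (Submodule.eq_bot_iff _).mpr fun v hv => ?_
  refine eq_zero_of_mem_jetRelations_of_eq_smul hm hQ 4 hv fun i => ?_
  exact exists_eq_smul_of_dirDeriv_quartic_eq_zero hC hS (fun h => hm i (by simp [h]))
    fun G hG hGp => dirDeriv_quartic_eq_zero_of_mem_jetRelations hQ hv hG hGp i

theorem finrank_jetRelations_seven_le_of_not_collinear [CharZero k] [DecidableEq ι]
    {m : Fin 3 → k} (hm : ∀ i, m ⬝ᵥ p i ≠ 0) {c : ι → k} {i : ι} (hci : c i ≠ 0)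
    (hQ : ∀ w : ι → k, ∃ Q : MvPolynomial (Fin 3) k, Q.IsHomogeneous 4 ∧ ∀ i, eval (p i) Q = w i)
    (hC : ∀ w : ι → k, c ⬝ᵥ w = 0 →
      ∃ Q : MvPolynomial (Fin 3) k, Q.IsHomogeneous 3 ∧ ∀ i, eval (p i) Q = w i)
    (hS : ∀ a : Fin 3 → k, (∀ j, c j ≠ 0 → a ⬝ᵥ p j = 0) → a = 0) :
    Module.finrank k (jetRelations p 7) ≤ 2 := by
  have hp : ∀ i, p i ≠ 0 := fun i h => hm i (by simp [h])
  rw [← finrank_orthogonal_singleton (hp i)]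
  refine finrank_le_of_injOn (crossProduct.flip (p i) ∘ₗ LinearMap.proj i)
    (fun v _ => dot_cross_self _ _) fun v hv h => ?_
  obtain ⟨μ, hμ⟩ : ∃ μ : k, v i = μ • p i := exists_eq_smul_of_cross_eq_zero (hp i) h
  refine eq_zero_of_mem_jetRelations_of_eq_smul hm hQ 3 hv fun j => ?_
  refine exists_eq_smul_of_dirDeriv_quartic_eq_zero hC hS (hp j) fun G hG hGp => ?_
  have h := dirDeriv_quartic_proportional_of_mem_jetRelations hC hv hG hGp i j
  rw [hμ, dirDeriv_smul_dir, dirDeriv_self _ hG, hGp, mul_zero, mul_zero, mul_zero] at h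
  exact (mul_eq_zero.mp h).resolve_left hci

theorem jetRelations_apply_eq_zero_of_not_mem_support [CharZero k] [DecidableEq ι]
    {m : Fin 3 → k} (hm : ∀ i, m ⬝ᵥ p i ≠ 0) {c : ι → k}
    (hC : ∀ w : ι → k, c ⬝ᵥ w = 0 →
      ∃ Q : MvPolynomial (Fin 3) k, Q.IsHomogeneous 3 ∧ ∀ i, eval (p i) Q = w i)
    (n : ℕ) (hv : v ∈ jetRelations p (6 + n + 1)) {i : ι} (hi : c i = 0) : v i = 0 := by
  obtain ⟨Q, hQ3, hQw⟩ := hC (Pi.single i 1) (by simp [hi])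
  refine jetRelations_apply_eq_zero hv (fun h => hm i (by simp [h])) (G := Q ^ 2 * linForm m ^ n)
    (by simpa using (hQ3.pow 2).mul ((linForm_isHomogeneous m).pow n)) ?_ fun j hj => Or.inr ?_
  · simp [hQw, eval_linForm, hm i]
  · have h0 : eval (p j) Q = 0 := by simp [hQw, hj]
    simp [dirDeriv_mul, dirDeriv_pow_two, h0]

theorem dotProduct_eq_zero_of_mem_jetRelations [DecidableEq ι]
    {m : Fin 3 → k} (hm : ∀ i, m ⬝ᵥ p i ≠ 0)
    (hQ : ∀ w : ι → k, ∃ Q : MvPolynomial (Fin 3) k, Q.IsHomogeneous 4 ∧ ∀ i, eval (p i) Q = w i)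
    (n : ℕ) (hv : v ∈ jetRelations p (4 + n + 1)) {a : Fin 3 → k}
    (ha : ∀ i, v i ≠ 0 → a ⬝ᵥ p i = 0) (i : ι) : a ⬝ᵥ v i = 0 := by
  obtain ⟨Q, hQ4, hQw⟩ := hQ (Pi.single i 1)
  have hF : (Q * linForm m ^ n).IsHomogeneous (4 + n) := by
    simpa using hQ4.mul ((linForm_isHomogeneous m).pow n)
  have hs := hv _ (hF.mul (linForm_isHomogeneous a))
  have hterm : ∀ j, dirDeriv (v j) (p j) (Q * linForm m ^ n * linForm a) =
      eval (p j) (Q * linForm m ^ n) * (a ⬝ᵥ v j) := fun j => by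
    rw [dirDeriv_mul, eval_linForm, dirDeriv_linForm]
    by_cases hj : v j = 0
    · simp [hj, dirDeriv_apply]
    · simp [ha j hj]
  simp only [hterm, map_mul, hQw, map_pow, eval_linForm] at hs
  rw [Fintype.sum_eq_single i fun j hj => by simp [hj]] at hs
  simpa [hm i] using hs

theorem finrank_jetRelations_seven_le_of_collinear [CharZero k] [DecidableEq ι]
    {m : Fin 3 → k} (hm : ∀ i, m ⬝ᵥ p i ≠ 0) {c : ι → k} {i : ι} (hci : c i ≠ 0)
    (hQ : ∀ w : ι → k, ∃ Q : MvPolynomial (Fin 3) k, Q.IsHomogeneous 4 ∧ ∀ i, eval (p i) Q = w i)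
    (hC : ∀ w : ι → k, c ⬝ᵥ w = 0 →
      ∃ Q : MvPolynomial (Fin 3) k, Q.IsHomogeneous 3 ∧ ∀ i, eval (p i) Q = w i)
    (hsep : ∀ i j, i ≠ j → ∃ b : Fin 3 → k, b ⬝ᵥ p i = 0 ∧ b ⬝ᵥ p j ≠ 0)
    {a : Fin 3 → k} (ha : a ≠ 0) {S : Finset ι} (hS : S.card ≤ 5)
    (hcS : ∀ j, c j ≠ 0 → j ∈ S ∧ a ⬝ᵥ p j = 0) :
    Module.finrank k (jetRelations p 7) ≤ 2 := by
  rw [← finrank_orthogonal_singleton ha]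
  have hsupp : ∀ v ∈ jetRelations p 7, ∀ j, v j ≠ 0 → c j ≠ 0 := fun v hv j hj hc =>
    hj (jetRelations_apply_eq_zero_of_not_mem_support hm hC 0 hv hc)
  refine finrank_le_of_injOn (LinearMap.proj i) (fun v hv => ?_) fun v hv h => ?_
  · exact dotProduct_eq_zero_of_mem_jetRelations hm hQ 2 hv
      (fun j hj => (hcS j (hsupp v hv j hj)).2) i
  · funext j
    by_contra hj
    have hji : j ≠ i := fun hji => hj (hji ▸ h)
    have hjS := (hcS j (hsupp v hv j hj)).1
    obtain ⟨G, hG, hGj, hGl⟩ := exists_sextic_singular hm hsep (T := (S.erase i).erase j) (j := j)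
      (by
        rw [Finset.card_erase_of_mem (by simp [hji, hjS]), Finset.card_erase_of_mem (hcS i hci).1]
        omega) (by simp)
    refine hj (jetRelations_apply_eq_zero hv (fun h => hm j (by simp [h])) hG hGj fun l hl => ?_)
    by_cases hvl : v l = 0
    · exact Or.inl hvl
    · have hli : l ≠ i := fun hli => hvl (hli ▸ h)
      have := hGl l (by simp [hl, hli, (hcS l (hsupp v hv l hvl)).1])
      exact Or.inr ⟨this.1, this.2 _⟩

theorem finrank_jetRelations_eight_le_of_collinear [CharZero k] [DecidableEq ι]
    {m : Fin 3 → k} (hm : ∀ i, m ⬝ᵥ p i ≠ 0) {c : ι → k} {i : ι} (hci : c i ≠ 0)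
    (hQ : ∀ w : ι → k, ∃ Q : MvPolynomial (Fin 3) k, Q.IsHomogeneous 4 ∧ ∀ i, eval (p i) Q = w i)
    (hC : ∀ w : ι → k, c ⬝ᵥ w = 0 →
      ∃ Q : MvPolynomial (Fin 3) k, Q.IsHomogeneous 3 ∧ ∀ i, eval (p i) Q = w i)
    (hsep : ∀ i j, i ≠ j → ∃ b : Fin 3 → k, b ⬝ᵥ p i = 0 ∧ b ⬝ᵥ p j ≠ 0)
    {a : Fin 3 → k} (ha : a ≠ 0) {S : Finset ι} (hS : S.card ≤ 5)
    (hcS : ∀ j, c j ≠ 0 → j ∈ S ∧ a ⬝ᵥ p j = 0) :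
    Module.finrank k (jetRelations p 8) ≤ 1 := by
  have hp : ∀ i, p i ≠ 0 := fun i h => hm i (by simp [h])
  have hsupp : ∀ v ∈ jetRelations p 8, ∀ j, v j ≠ 0 → c j ≠ 0 := fun v hv j hj hc =>
    hj (jetRelations_apply_eq_zero_of_not_mem_support hm hC 1 hv hc)
  refine (finrank_le_of_injOn (W := Submodule.span k {a})
    (crossProduct.flip (p i) ∘ₗ LinearMap.proj i) (fun v hv => ?_) fun v hv h => ?_).trans
      (by simpa using finrank_span_le_card (R := k) ({a} : Set (Fin 3 → k)))
  · have hav := dotProduct_eq_zero_of_mem_jetRelations hm hQ 3 hv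
      (fun j hj => (hcS j (hsupp v hv j hj)).2) i
    obtain ⟨μ, hμ⟩ : ∃ μ : k, v i ⨯₃ p i = μ • a := by
      refine exists_eq_smul_of_cross_eq_zero ha ?_
      rw [← cross_anticomm, cross_cross_eq_smul_sub_smul', dotProduct_comm (v i), hav, (hcS i hci).2]
      simp
    exact Submodule.mem_span_singleton.mpr ⟨μ, hμ.symm⟩
  · obtain ⟨μ, hμ⟩ : ∃ μ : k, v i = μ • p i := exists_eq_smul_of_cross_eq_zero (hp i) h
    refine eq_zero_of_mem_jetRelations_of_eq_smul hm hQ 4 hv fun j => ?_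
    by_cases hji : j = i
    · exact ⟨μ, hji ▸ hμ⟩
    refine ⟨0, ?_⟩
    rw [zero_smul]
    by_contra hj
    have hjS := (hcS j (hsupp v hv j hj)).1
    obtain ⟨G, hG, hGj, hGl⟩ := exists_sextic_singular hm hsep (T := (S.erase i).erase j) (j := j)
      (by
        rw [Finset.card_erase_of_mem (by simp [hji, hjS]), Finset.card_erase_of_mem (hcS i hci).1]
        omega) (by simp)
    obtain ⟨b, hbi, hbj⟩ := hsep i j (Ne.symm hji)
    have hbG := hG.mul (linForm_isHomogeneous b)
    refine hj (jetRelations_apply_eq_zero hv (hp j) hbG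
      (by simp [eval_linForm, hGj, hbj]) fun l hl => ?_)
    by_cases hli : l = i
    · subst hli
      refine Or.inr ⟨by simp [eval_linForm, hbi], ?_⟩
      rw [hμ, dirDeriv_smul_dir, dirDeriv_self _ hbG, map_mul, eval_linForm, hbi]
      ring
    by_cases hvl : v l = 0
    · exact Or.inl hvl
    · have := hGl l (by simp [hl, hli, (hcS l (hsupp v hv l hvl)).1])
      exact Or.inr ⟨by simp [this.1], by simp [dirDeriv_mul, this.1, this.2]⟩

theorem jetRelations_eq_bot_of_nine_le [CharZero k] [DecidableEq ι]
    {m : Fin 3 → k} (hm : ∀ i, m ⬝ᵥ p i ≠ 0)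
    (hQ : ∀ w : ι → k, ∃ Q : MvPolynomial (Fin 3) k, Q.IsHomogeneous 4 ∧ ∀ i, eval (p i) Q = w i)
    (n : ℕ) : jetRelations p (8 + n + 1) = ⊥ := by
  refine (Submodule.eq_bot_iff _).mpr fun v hv => funext fun i => ?_
  obtain ⟨Q, hQ4, hQw⟩ := hQ (Pi.single i 1)
  refine jetRelations_apply_eq_zero hv (fun h => hm i (by simp [h])) (G := Q ^ 2 * linForm m ^ n)
    (by simpa using (hQ4.pow 2).mul ((linForm_isHomogeneous m).pow n)) ?_ fun j hj => Or.inr ?_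
  · simp [hQw, eval_linForm, hm i]
  · have h0 : eval (p j) Q = 0 := by simp [hQw, hj]
    simp [dirDeriv_mul, dirDeriv_pow_two, h0]

end Relations

section SingularForms

variable {ι : Type} {p : ι → Fin 3 → k}

theorem mul_mem_singularForms {F G : MvPolynomial (Fin 3) k} {s t : ℕ} (hF : F.IsHomogeneous s)
    (hG : G.IsHomogeneous t) (hF0 : ∀ i, eval (p i) F = 0)
    (hF1 : ∀ i u, dirDeriv u (p i) F = 0) : F * G ∈ singularForms p (s + t) :=
  ⟨hF.mul hG, fun i u => by simp [dirDeriv_mul, hF0, hF1]⟩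

theorem eval_eq_zero_of_mem_singularForms [CharZero k] {F : MvPolynomial (Fin 3) k} {t : ℕ}
    (hF : F ∈ singularForms p (t + 1)) (i : ι) : eval (p i) F = 0 := by
  have h := dirDeriv_self (p i) hF.1
  rw [hF.2, eq_comm, mul_eq_zero, or_iff_right (by exact_mod_cast t.succ_ne_zero)] at h
  exact h

theorem eq_zero_of_finrank_singularForms_seven_le
    (h7 : Module.finrank k (singularForms p 7) ≤ 5) {F : MvPolynomial (Fin 3) k} {t : ℕ}
    (ht : t ≤ 5) (hF : F.IsHomogeneous t) (hF0 : ∀ i, eval (p i) F = 0)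
    (hF1 : ∀ i u, dirDeriv u (p i) F = 0) : F = 0 := by
  by_contra hne
  have hmem : ∀ G ∈ homogeneousSubmodule (Fin 3) k (7 - t),
      LinearMap.mulLeft k F G ∈ singularForms p 7 := fun G hG => by
    have := mul_mem_singularForms hF hG hF0 hF1
    rwa [Nat.add_sub_cancel' (by omega)] at this
  have h := LinearMap.finrank_le_finrank_of_injective (f := (LinearMap.mulLeft k F).restrict hmem)
    fun G H hGH => Subtype.ext (mul_left_cancel₀ hne (congrArg Subtype.val hGH))
  rw [finrank_homogeneousSubmodule_fin_three] at h
  have h2 : (4 : ℕ).choose 2 ≤ (7 - t + 2).choose 2 := Nat.choose_le_choose 2 (by omega)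
  have h3 : (4 : ℕ).choose 2 = 6 := rfl
  omega

theorem isHomogeneous_of_mul_linear {L c : MvPolynomial (Fin 3) k} (hL : L.IsHomogeneous 1)
    (hL0 : L ≠ 0) {n : ℕ} (h : (L * c).IsHomogeneous (n + 1)) : c.IsHomogeneous n := by
  have key : homogeneousComponent (n + 1) (L * c) = L * homogeneousComponent n c := by
    conv_lhs => rw [← sum_homogeneousComponent c, Finset.mul_sum, map_sum]
    have hterm : ∀ i, homogeneousComponent (n + 1) (L * homogeneousComponent i c) =
        if n = i then L * homogeneousComponent i c else 0 := fun i => by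
      rw [homogeneousComponent_of_mem
        (hL.mul (homogeneousComponent_isHomogeneous i c) : (_ : MvPolynomial _ k).IsHomogeneous _)]
      congr 1
      simp only [add_comm 1 i, add_left_inj]
    simp only [hterm, Finset.sum_ite_eq, Finset.mem_range]
    split_ifs with hn
    · rfl
    · rw [homogeneousComponent_eq_zero _ _ (by omega), mul_zero]
  rw [homogeneousComponent_of_mem h, if_pos rfl] at key
  rw [mul_left_cancel₀ hL0 key]
  exact homogeneousComponent_isHomogeneous n c

theorem linForm_ne_zero {a : Fin 3 → k} (ha : a ≠ 0) : linForm a ≠ 0 := fun h => ha <| by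
  ext j
  have := eval_linForm a (Pi.single j 1)
  simpa [h] using this.symm

theorem prime_linForm {a : Fin 3 → k} (ha : a ≠ 0) : Prime (linForm a) := by
  rw [← UniqueFactorizationMonoid.irreducible_iff_prime]
  refine irreducible_of_totalDegree_eq_one
    ((linForm_isHomogeneous a).totalDegree (linForm_ne_zero ha)) fun x hx => ?_
  refine isUnit_iff_ne_zero.mpr fun h0 => linForm_ne_zero ha (MvPolynomial.ext _ _ fun d => ?_)
  simpa [h0] using hx d

theorem finrank_singularForms_six_le [CharZero k] {m : Fin 3 → k} (hm0 : m ≠ 0)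
    (hm : ∀ i, m ⬝ᵥ p i ≠ 0) (h7 : Module.finrank k (singularForms p 7) ≤ 5) :
    Module.finrank k (singularForms p 6) ≤ 2 := by
  obtain ⟨q, hmq, hq⟩ : ∃ q : Fin 3 → k, m ⬝ᵥ q = 0 ∧ q ≠ 0 := by
    have h := finrank_orthogonal_singleton hm0
    obtain ⟨q, hq, hq0⟩ := Submodule.exists_mem_ne_zero_of_ne_bot
      (p := LinearMap.ker (dotProductEquiv k (Fin 3) m)) fun hb => by
        rw [hb, finrank_bot] at h
        omega
    exact ⟨q, hq, hq0⟩
  obtain ⟨j, hj⟩ := Function.ne_iff.mp hq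
  have hmem : ∀ (L : MvPolynomial (Fin 3) k), L.IsHomogeneous 1 → ∀ G ∈ singularForms p 6,
      LinearMap.mulLeft k L G ∈ singularForms p 7 := fun L hL G hG => by
    rw [LinearMap.mulLeft_apply, mul_comm]
    exact mul_mem_singularForms hG.1 hL (eval_eq_zero_of_mem_singularForms hG) hG.2
  let f := ((LinearMap.mulLeft k (linForm m)).restrict (hmem _ (linForm_isHomogeneous m))).coprod
    ((LinearMap.mulLeft k (X j)).restrict (hmem _ (isHomogeneous_X k j)))
  have hf : Function.Injective f := by
    rw [← LinearMap.ker_eq_bot, LinearMap.ker_eq_bot']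
    rintro ⟨⟨a, ha⟩, ⟨b, hb⟩⟩ h
    have hab : linForm m * a + X j * b = 0 := congrArg Subtype.val h
    have hdvd : linForm m ∣ X j * b := ⟨-a, by linear_combination hab⟩
    obtain ⟨d, hd⟩ | ⟨d, rfl⟩ := (prime_linForm hm0).dvd_or_dvd hdvd
    · have := congrArg (eval q) hd
      rw [map_mul, eval_linForm, hmq, zero_mul, eval_X] at this
      exact absurd this hj
    · have hd5 := isHomogeneous_of_mul_linear (linForm_isHomogeneous m) (linForm_ne_zero hm0) hb.1
      have hd0 : ∀ i, eval (p i) d = 0 := fun i => by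
        have := eval_eq_zero_of_mem_singularForms hb i
        rw [map_mul, eval_linForm] at this
        exact (mul_eq_zero.mp this).resolve_left (hm i)
      have hd1 : ∀ i u, dirDeriv u (p i) d = 0 := fun i u => by
        have := hb.2 i u
        rw [dirDeriv_mul, hd0, mul_zero, zero_add, eval_linForm] at this
        exact (mul_eq_zero.mp this).resolve_left (hm i)
      have hdz := eq_zero_of_finrank_singularForms_seven_le h7 le_rfl hd5 hd0 hd1
      subst hdz
      rw [mul_zero, mul_zero, add_zero, mul_eq_zero, or_iff_right (linForm_ne_zero hm0)] at hab
      subst hab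
      simp
  have h := LinearMap.finrank_le_finrank_of_injective hf
  rw [Module.finrank_prod] at h
  omega

end SingularForms

section Configuration

variable {p : Fin 11 → Fin 3 → k}

theorem card_collinear_le
    (h3 : ∀ F : MvPolynomial (Fin 3) k, F.IsHomogeneous 3 → (∀ i, eval (p i) F = 0) → F = 0)
    {a : Fin 3 → k} (ha : a ≠ 0) {S : Finset (Fin 11)} (hS : ∀ i ∈ S, a ⬝ᵥ p i = 0) :
    S.card ≤ 5 := by
  by_contra! hcard
  let f : MvPolynomial (Fin 3) k →ₗ[k] ((Sᶜ : Finset (Fin 11)) → k) :=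
    LinearMap.pi fun i => (aeval (p i)).toLinearMap
  have hlt : Module.finrank k ((Sᶜ : Finset (Fin 11)) → k) <
      Module.finrank k (homogeneousSubmodule (Fin 3) k 2) := by
    rw [finrank_homogeneousSubmodule_fin_three, Module.finrank_fintype_fun_eq_card,
      Fintype.card_coe, Finset.card_compl, Fintype.card_fin]
    have : (2 + 2).choose 2 = 6 := rfl
    omega
  obtain ⟨⟨q, hq2⟩, hq, hq0⟩ := Submodule.exists_mem_ne_zero_of_ne_bot
    (LinearMap.ker_ne_bot_of_finrank_lt (f := f.domRestrict (homogeneousSubmodule (Fin 3) k 2)) hlt)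
  have hF := h3 (linForm a * q) ((linForm_isHomogeneous a).mul hq2) fun i => by
    rw [map_mul, eval_linForm]
    by_cases hi : i ∈ S
    · rw [hS i hi, zero_mul]
    · have : aeval (p i) q = 0 := congrFun hq ⟨i, Finset.mem_compl.mpr hi⟩
      rw [aeval_eq_eval] at this
      exact mul_eq_zero_of_right _ this
  exact hq0 (Subtype.ext ((mul_eq_zero.mp hF).resolve_left (linForm_ne_zero ha)))

theorem finrank_jetRelations_seven_le_and_eight_le [CharZero k]
    {m : Fin 3 → k} (hm : ∀ i, m ⬝ᵥ p i ≠ 0) {c : Fin 11 → k} (hc : c ≠ 0)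
    (hQ : ∀ w : Fin 11 → k,
      ∃ Q : MvPolynomial (Fin 3) k, Q.IsHomogeneous 4 ∧ ∀ i, eval (p i) Q = w i)
    (hC : ∀ w : Fin 11 → k, c ⬝ᵥ w = 0 →
      ∃ Q : MvPolynomial (Fin 3) k, Q.IsHomogeneous 3 ∧ ∀ i, eval (p i) Q = w i)
    (h3 : ∀ F : MvPolynomial (Fin 3) k, F.IsHomogeneous 3 → (∀ i, eval (p i) F = 0) → F = 0)
    (hsep : ∀ i j, i ≠ j → ∃ b : Fin 3 → k, b ⬝ᵥ p i = 0 ∧ b ⬝ᵥ p j ≠ 0) :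
    Module.finrank k (jetRelations p 7) ≤ 2 ∧ Module.finrank k (jetRelations p 8) ≤ 1 := by
  classical
  obtain ⟨i, hci⟩ := Function.ne_iff.mp hc
  by_cases hS : ∀ a : Fin 3 → k, (∀ j, c j ≠ 0 → a ⬝ᵥ p j = 0) → a = 0
  · rw [jetRelations_eight_eq_bot_of_not_collinear hm hQ hC hS, finrank_bot]
    exact ⟨finrank_jetRelations_seven_le_of_not_collinear hm hci hQ hC hS, Nat.zero_le _⟩
  · push Not at hS
    obtain ⟨a, haS, ha⟩ := hS
    have hcard : ({j | c j ≠ 0} : Finset (Fin 11)).card ≤ 5 :=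
      card_collinear_le h3 ha fun j hj => haS j (Finset.mem_filter.mp hj).2
    have hcS : ∀ j, c j ≠ 0 → j ∈ ({j | c j ≠ 0} : Finset (Fin 11)) ∧ a ⬝ᵥ p j = 0 :=
      fun j hj => ⟨Finset.mem_filter.mpr ⟨Finset.mem_univ j, hj⟩, haS j hj⟩
    exact ⟨finrank_jetRelations_seven_le_of_collinear hm hci hQ hC hsep ha hcard hcS,
      finrank_jetRelations_eight_le_of_collinear hm hci hQ hC hsep ha hcard hcS⟩

end Configuration

section Ideals

theorem eval_eq_zero_of_mem_pointIdeal {P : Projectivization k (Fin 3 → k)}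
    {f : MvPolynomial (Fin 3) k} (hf : f ∈ pointIdeal k P) : eval P.rep f = 0 := by
  have h : pointIdeal k P ≤ RingHom.ker (eval P.rep) := Ideal.span_le.mpr fun g hg => hg.2
  exact h hf

theorem aeval_mul_of_isHomogeneous {A : Type} [CommRing A] [Algebra k A] {t : ℕ}
    {f : MvPolynomial (Fin 3) k} (hf : f.IsHomogeneous t) (a : Fin 3 → A) (y : A) :
    aeval (fun j => a j * y) f = aeval a f * y ^ t := by
  simp only [aeval_def, eval₂_eq', Finset.sum_mul, mul_assoc, mul_pow, Finset.prod_mul_distrib,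
    Finset.prod_pow_eq_pow_sum]
  refine Finset.sum_congr rfl fun d hd => ?_
  rw [← Finsupp.degree_eq_sum, hf.degree_eq_sum_deg_support hd, Finsupp.degree_apply]

theorem mem_pointIdeal_of_eval_eq_zero {P : Projectivization k (Fin 3 → k)}
    {f : MvPolynomial (Fin 3) k} {t : ℕ} (hf : f.IsHomogeneous t) (h0 : eval P.rep f = 0) :
    f ∈ pointIdeal k P := by
  obtain ⟨i, hi⟩ := Function.ne_iff.mp P.rep_nonzero
  replace hi : P.rep i ≠ 0 := hi
  let a : Fin 3 → k := fun j => P.rep j / P.rep i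
  have ha : aeval a f = 0 := by
    have h := aeval_mul_of_isHomogeneous hf a (P.rep i)
    have h1 : (fun j => a j * P.rep i) = P.rep := funext fun j => div_mul_cancel₀ _ hi
    rw [h1, aeval_eq_eval, h0, eq_comm, mul_eq_zero,
      or_iff_left (pow_ne_zero _ hi)] at h
    exact h
  let π := Ideal.Quotient.mkₐ k (pointIdeal k P)
  have hπ : π = aeval fun j => algebraMap k _ (a j) * π (X i) := by
    refine algHom_ext fun j => ?_
    rw [aeval_X, ← π.commutes, ← map_mul, ← sub_eq_zero, ← map_sub]
    refine Ideal.Quotient.eq_zero_iff_mem.mpr (Ideal.subset_span ⟨?_, ?_⟩)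
    · exact (isHomogeneous_X k j).sub (isHomogeneous_C_mul_X _ _)
    · simp [a, hi]
  refine Ideal.Quotient.eq_zero_iff_mem.mp (?_ : π f = 0)
  rw [hπ, aeval_mul_of_isHomogeneous hf]
  refine mul_eq_zero_of_left ?_ _
  exact (aeval_algebraMap_apply _ a f).trans (by rw [ha, map_zero])

theorem dirDeriv_eq_zero_of_mem_pointIdeal_sq {P : Projectivization k (Fin 3 → k)}
    {f : MvPolynomial (Fin 3) k} (hf : f ∈ pointIdeal k P ^ 2) (u : Fin 3 → k) :
    dirDeriv u P.rep f = 0 := by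
  rw [pow_two] at hf
  induction hf using Submodule.mul_induction_on' with
  | mem_mul_mem g hg h hh =>
    simp [dirDeriv_mul, eval_eq_zero_of_mem_pointIdeal hg, eval_eq_zero_of_mem_pointIdeal hh]
  | add g _ h _ hg hh => rw [map_add, hg, hh, add_zero]

variable {s : ℕ} (P : Fin s → Projectivization k (Fin 3 → k))

/-- Evaluation of the forms of degree `t` at the representatives of the points `P i`. -/
noncomputable def evalForms (t : ℕ) : homogeneousSubmodule (Fin 3) k t →ₗ[k] (Fin s → k) :=
  (LinearMap.pi fun i => (aeval (P i).rep).toLinearMap).domRestrict (homogeneousSubmodule (Fin 3) k t)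

theorem evalForms_apply {t : ℕ} (f : homogeneousSubmodule (Fin 3) k t) (i : Fin s) :
    evalForms P t f i = eval (P i).rep f.1 := by
  simp [evalForms, aeval_eq_eval]

theorem map_ker_evalForms (t : ℕ) : (LinearMap.ker (evalForms P t)).map (Submodule.subtype _) =
    Submodule.restrictScalars k (idealOfPoints k P) ⊓ homogeneousSubmodule (Fin 3) k t := by
  ext f
  simp only [Submodule.mem_map, LinearMap.mem_ker, Submodule.subtype_apply, Subtype.exists,
    exists_and_right, exists_eq_right, Submodule.mem_inf, Submodule.restrictScalars_mem,
    idealOfPoints, Submodule.mem_iInf]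
  constructor
  · rintro ⟨hf, h⟩
    refine ⟨fun i => mem_pointIdeal_of_eval_eq_zero hf ?_, hf⟩
    rw [← evalForms_apply P ⟨f, hf⟩, h, Pi.zero_apply]
  · rintro ⟨h, hf⟩
    refine ⟨hf, funext fun i => ?_⟩
    rw [evalForms_apply, Pi.zero_apply]
    exact eval_eq_zero_of_mem_pointIdeal (h i)

theorem finrank_range_evalForms (t : ℕ) :
    Module.finrank k (LinearMap.range (evalForms P t)) =
      hilbertFunction k (idealOfPoints k P) t := by
  rw [hilbertFunction, ← map_ker_evalForms, Submodule.finrank_map_subtype_eq,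
    ← LinearMap.finrank_range_add_finrank_ker (evalForms P t), Nat.add_sub_cancel]

theorem choose_le_hilbertFunction_doubleIdeal_add (t : ℕ) :
    (t + 2).choose 2 ≤ hilbertFunction k (doubleIdealOfPoints k P) t +
      Module.finrank k (singularForms (fun i => (P i).rep) t) := by
  have hle : Submodule.restrictScalars k (doubleIdealOfPoints k P) ⊓
      homogeneousSubmodule (Fin 3) k t ≤ singularForms (fun i => (P i).rep) t := fun f hf =>
    ⟨hf.2, fun i u => dirDeriv_eq_zero_of_mem_pointIdeal_sq
      ((Submodule.mem_iInf _).mp hf.1 i) u⟩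
  have h := Submodule.finrank_mono hle
  rw [hilbertFunction, finrank_homogeneousSubmodule_fin_three]
  omega

theorem hilbertFunction_doubleIdeal_eq_choose {t : ℕ}
    (h : ∀ f : MvPolynomial (Fin 3) k, f.IsHomogeneous t → (∀ i, eval (P i).rep f = 0) →
      (∀ i u, dirDeriv u (P i).rep f = 0) → f = 0) :
    hilbertFunction k (doubleIdealOfPoints k P) t = (t + 2).choose 2 := by
  have hbot : Submodule.restrictScalars k (doubleIdealOfPoints k P) ⊓
      homogeneousSubmodule (Fin 3) k t = ⊥ := (Submodule.eq_bot_iff _).mpr fun f hf => by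
    have hf1 := (Submodule.mem_iInf _).mp hf.1
    exact h f hf.2 (fun i => eval_eq_zero_of_mem_pointIdeal (Ideal.pow_le_self two_ne_zero (hf1 i)))
      fun i => dirDeriv_eq_zero_of_mem_pointIdeal_sq (hf1 i)
  rw [hilbertFunction, hbot, finrank_bot, finrank_homogeneousSubmodule_fin_three, Nat.sub_zero]

theorem exists_quartic_of_hasGenericHilbertFunction {P : Fin 11 → Projectivization k (Fin 3 → k)}
    (hgen : HasGenericHilbertFunction k P) (w : Fin 11 → k) :
    ∃ Q : MvPolynomial (Fin 3) k, Q.IsHomogeneous 4 ∧ ∀ i, eval (P i).rep Q = w i := by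
  have htop : LinearMap.range (evalForms P 4) = ⊤ := by
    refine Submodule.eq_top_of_finrank_eq ?_
    rw [finrank_range_evalForms, hgen, Module.finrank_fin_fun]
    rfl
  obtain ⟨Q, rfl⟩ := LinearMap.range_eq_top.mp htop w
  exact ⟨Q, Q.2, fun i => (evalForms_apply P Q i).symm⟩

theorem eq_zero_of_cubic_of_hasGenericHilbertFunction
    {P : Fin 11 → Projectivization k (Fin 3 → k)} (hgen : HasGenericHilbertFunction k P)
    (F : MvPolynomial (Fin 3) k) (hF : F.IsHomogeneous 3) (h0 : ∀ i, eval (P i).rep F = 0) :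
    F = 0 := by
  have h := LinearMap.finrank_range_add_finrank_ker (evalForms P 3)
  rw [finrank_range_evalForms, hgen, finrank_homogeneousSubmodule_fin_three] at h
  have h10 : (3 + 2).choose 2 = 10 := rfl
  replace h : Module.finrank k (LinearMap.ker (evalForms P 3)) = 0 := by omega
  rw [Submodule.finrank_eq_zero] at h
  have hmem : (⟨F, hF⟩ : homogeneousSubmodule (Fin 3) k 3) ∈ LinearMap.ker (evalForms P 3) := by
    rw [LinearMap.mem_ker]
    ext i
    rw [evalForms_apply]
    exact h0 i
  rw [h, Submodule.mem_bot] at hmem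
  exact congrArg Subtype.val hmem

theorem exists_cubic_of_hasGenericHilbertFunction {P : Fin 11 → Projectivization k (Fin 3 → k)}
    (hgen : HasGenericHilbertFunction k P) : ∃ c : Fin 11 → k, c ≠ 0 ∧ ∀ w, c ⬝ᵥ w = 0 →
      ∃ Q : MvPolynomial (Fin 3) k, Q.IsHomogeneous 3 ∧ ∀ i, eval (P i).rep Q = w i := by
  have hr : Module.finrank k (LinearMap.range (evalForms P 3)) = 10 := by
    rw [finrank_range_evalForms, hgen]
    rfl
  obtain ⟨φ, hφ0, hφ⟩ := Submodule.exists_le_ker_of_lt_top (LinearMap.range (evalForms P 3)) <|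
    Submodule.lt_top_of_finrank_lt_finrank (by rw [hr, Module.finrank_fin_fun]; omega)
  have hk := Module.Dual.finrank_ker_add_one_of_ne_zero hφ0
  rw [Module.finrank_fin_fun] at hk
  have heq := Submodule.eq_of_le_of_finrank_eq hφ (by omega)
  refine ⟨(dotProductEquiv k (Fin 11)).symm φ, by simpa using hφ0, fun w hw => ?_⟩
  rw [← dotProductEquiv_apply_apply, LinearEquiv.apply_symm_apply] at hw
  obtain ⟨Q, rfl⟩ := heq.ge (LinearMap.mem_ker.mpr hw)
  exact ⟨Q, Q.2, fun i => (evalForms_apply P Q i).symm⟩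

theorem exists_dotProduct_rep_eq_zero_and_ne_zero {P Q : Projectivization k (Fin 3 → k)}
    (h : P ≠ Q) : ∃ b : Fin 3 → k, b ⬝ᵥ P.rep = 0 ∧ b ⬝ᵥ Q.rep ≠ 0 := by
  have hcross := crossProduct_ne_zero_iff_linearIndependent.mpr
    (Projectivization.linearIndependent_pair_iff_ne.mpr h)
  obtain ⟨j, hj⟩ := Function.ne_iff.mp hcross
  refine ⟨Pi.single j 1 ⨯₃ P.rep, ?_, ?_⟩
  · rw [dotProduct_comm, dot_cross_self]
  · rw [dotProduct_comm, triple_product_permutation]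
    simpa using hj

end Ideals

end DoublePoints

/-- For any set of 11 distinct points of ℙ² with generic Hilbert function,
the Hilbert function of the double point scheme is bounded below pointwise by
m(t) = binom(t+2,2) for t ≤ 5, m(6) = 26, m(7) = 31, m(8) = 32, m(t) = 33 for t ≥ 9. -/
theorem statement0 (k : Type) [Field k] [IsAlgClosed k] [CharZero k]
    (P : Fin 11 → Projectivization k (Fin 3 → k)) (hinj : Function.Injective P)
    (hgen : HasGenericHilbertFunction k P) :
    ∀ t : ℕ,
      (if t ≤ 5 then Nat.choose (t + 2) 2
        else if t = 6 then 26
        else if t = 7 then 31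
        else if t = 8 then 32
        else 33)
      ≤ hilbertFunction k (doubleIdealOfPoints k P) t := by
  intro t
  obtain ⟨m, hm⟩ := exists_dotProduct_ne_zero (fun i => (P i).rep) fun i => (P i).rep_nonzero
  have hm0 : m ≠ 0 := fun h => hm 0 (by simp [h])
  have hQ := exists_quartic_of_hasGenericHilbertFunction hgen
  obtain ⟨c, hc, hC⟩ := exists_cubic_of_hasGenericHilbertFunction hgen
  obtain ⟨h7, h8⟩ := finrank_jetRelations_seven_le_and_eight_le hm hc hQ hC
    (eq_zero_of_cubic_of_hasGenericHilbertFunction hgen)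
    fun i j hij => exists_dotProduct_rep_eq_zero_and_ne_zero (hinj.ne hij)
  have hK := finrank_singularForms_add_le fun i => (P i).rep
  rw [Fintype.card_fin] at hK
  have hK7 : Module.finrank k (singularForms (fun i => (P i).rep) 7) ≤ 5 := by
    have : (7 + 2).choose 2 = 36 := rfl
    have := hK 7
    omega
  have hH := choose_le_hilbertFunction_doubleIdeal_add P t
  split_ifs with h5 h6 h7 h8
  · exact (hilbertFunction_doubleIdeal_eq_choose P fun f =>
      eq_zero_of_finrank_singularForms_seven_le hK7 h5).ge
  · subst h6
    have hK6 := finrank_singularForms_six_le hm0 hm hK7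
    have : (6 + 2).choose 2 = 28 := rfl
    omega
  · subst h7
    have : (7 + 2).choose 2 = 36 := rfl
    omega
  · subst h8
    have := hK 8
    omega
  · obtain ⟨n, rfl⟩ : ∃ n, t = 8 + n + 1 := ⟨t - 9, by omega⟩
    have := hK (8 + n + 1)
    rw [jetRelations_eq_bot_of_nine_le hm hQ, finrank_bot] at this
    omega
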